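/- arXiv:0909.3637 — 6 statements merged into one kernel-verified Lean document; each statement's English description precedes it below -/
import Mathlib

section
/- For every finite instance of packets and every buffer size B ≥ 1, the total value of the packets transmitted by GRQ is at least half of the maximum total value of a B-feasible subset of the released packets; that is, GRQ is 2-competitive. -/
attribute [local instance] Classical.propDecidable

structure Packet where
  r : ℕ
  d : ℕ
  v : ℝ

noncomputable def totalValue (S : Finset Packet) : ℝ := ∑ p ∈ S, p.v

def Feasible (B : ℕ) (S : Finset Packet) : Prop :=
  ∃ σ : Packet → ℕ, Set.InjOn σ ↑S ∧ (∀ p ∈ S, p.r ≤ σ p ∧ σ p ≤ p.d) ∧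
    ∀ t : ℕ, (S.filter fun p => p.r ≤ t ∧ t ≤ σ p).card ≤ B

/-- The processing order used by GRQ: non-increasing value, ties broken by the
fixed linear order `tie` on packets. -/
def ValOrder (tie : Packet → Packet → Prop) (p q : Packet) : Prop :=
  q.v < p.v ∨ (p.v = q.v ∧ tie p q)

/-- Given the (value-sorted) candidate list of packets at time `t`, retain packets
greedily: the packet currently considered for (0-indexed) position `i` is retained
iff some position among `0, …, B-1` remains and its tentative transmission time
`t + i` does not exceed its deadline; otherwise it is dropped permanently. -/
def retain (B t : ℕ) : ℕ → List Packet → List Packet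
  | _, [] => []
  | i, p :: rest =>
      if i < B ∧ t + i ≤ p.d then p :: retain B t (i + 1) rest
      else retain B t i rest

/-- Process the arrivals of step `t` one at a time: when packet `j` arrives, the stored
packets together with `j` are re-sorted in non-increasing value order (ties broken by
`tie`) and retained greedily. -/
noncomputable def grqArrive (B : ℕ) (tie : Packet → Packet → Prop) (t : ℕ)
    (buf : List Packet) (arrivals : List Packet) : List Packet :=
  arrivals.foldl (fun b j => retain B t 0 (List.insertionSort (ValOrder tie) (j :: b))) buf

/-- The state of GRQ after step `t`: the pair (buffer carried over to step `t+1`,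
list of packets transmitted during steps `0, …, t`).  In each step, after all arrivals
are processed, the first (maximum-value) stored packet, whose tentative transmission
time is `t`, is transmitted, if any. -/
noncomputable def grqState (B : ℕ) (tie : Packet → Packet → Prop)
    (arr : ℕ → List Packet) : ℕ → List Packet × List Packet
  | 0 =>
      let b := grqArrive B tie 0 [] (arr 0)
      (b.tail, b.take 1)
  | t + 1 =>
      let s := grqState B tie arr t
      let b := grqArrive B tie (t + 1) s.1 (arr (t + 1))
      (b.tail, s.2 ++ b.take 1)

section Counting

/-- Comparing two finite families through the sizes of all their superlevel sets compares
their sums. -/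
theorem sum_le_sum_of_card_superlevel_le {α β : Type*} (S : Finset α) (T : Finset β)
    (f : α → ℝ) (g : β → ℝ) (hg : ∀ q ∈ T, 0 ≤ g q)
    (h : ∀ x : ℝ, (S.filter fun p => x ≤ f p).card ≤ (T.filter fun q => x ≤ g q).card) :
    ∑ p ∈ S, f p ≤ ∑ q ∈ T, g q := by
  induction hn : S.card generalizing S T with
  | zero =>
    rw [Finset.card_eq_zero] at hn
    subst hn
    simpa using Finset.sum_nonneg hg
  | succ n ih =>
    obtain ⟨p, hp, hpmax⟩ := Finset.exists_max_image S f (Finset.card_pos.1 (by omega))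
    have hpos : 0 < (T.filter fun q => f p ≤ g q).card :=
      lt_of_lt_of_le (Finset.card_pos.2 ⟨p, by simp [hp]⟩) (h (f p))
    obtain ⟨q₀, hq₀⟩ := Finset.card_pos.1 hpos
    rw [Finset.mem_filter] at hq₀
    obtain ⟨q, hq, hqmax⟩ := Finset.exists_max_image T g ⟨q₀, hq₀.1⟩
    have hpq : f p ≤ g q := hq₀.2.trans (hqmax _ hq₀.1)
    have key : ∑ p ∈ S.erase p, f p ≤ ∑ q ∈ T.erase q, g q := by
      refine ih _ _ (fun q' hq' => hg _ (Finset.mem_of_mem_erase hq')) (fun x => ?_)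
        (by rw [Finset.card_erase_of_mem hp]; omega)
      rw [Finset.filter_erase, Finset.filter_erase]
      by_cases hx : x ≤ f p
      · rw [Finset.card_erase_of_mem (by simp [hp, hx]),
          Finset.card_erase_of_mem (by simp [hq, hx.trans hpq])]
        exact Nat.sub_le_sub_right (h x) 1
      · rw [Finset.filter_eq_empty_iff.2
          fun p' hp' hx' => hx (hx'.trans (hpmax p' hp'))]
        simp
    rw [← Finset.add_sum_erase S f hp, ← Finset.add_sum_erase T g hq]
    exact add_le_add hpq key

theorem exists_maximal_run (busy : ℕ → Prop) (t : ℕ) :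
    ∃ a ≤ t, (∀ u, a ≤ u → u < t → busy u) ∧ (a = 0 ∨ ∃ b, a = b + 1 ∧ ¬ busy b) := by
  induction t with
  | zero => exact ⟨0, le_rfl, fun u _ hu => absurd hu (by omega), Or.inl rfl⟩
  | succ t ih =>
    by_cases hb : busy t
    · obtain ⟨a, ha, hrun, hstart⟩ := ih
      refine ⟨a, by omega, fun u hau hut => ?_, hstart⟩
      rcases Nat.lt_succ_iff_lt_or_eq.1 hut with h | rfl
      exacts [hrun u hau h, hb]
    · exact ⟨t + 1, le_rfl, fun u h₁ h₂ => absurd h₂ (by omega), Or.inr ⟨t, rfl, hb⟩⟩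

/-- Unweighted competitiveness. `sent t` is the packet transmitted at time `t` and `busy` marks
the times counted as active; every packet of `S` that is still available at an idle time has been
transmitted before, or the buffer has been full, forcing `B` consecutive busy steps. -/
theorem card_le_two_mul_card_busy {B N : ℕ} {S : Finset Packet} {σ : Packet → ℕ}
    (hinj : Set.InjOn σ ↑S) (hσ : ∀ p ∈ S, p.r ≤ σ p ∧ σ p ≤ p.d)
    (hbuf : ∀ t : ℕ, (S.filter fun p => p.r ≤ t ∧ t ≤ σ p).card ≤ B)
    (hN : ∀ p ∈ S, p.d ≤ N) (busy : ℕ → Prop) [DecidablePred busy]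
    (sent : ℕ → Option Packet)
    (hserve : ∀ p ∈ S, ∀ s, p.r ≤ s → s ≤ p.d → ¬ busy s →
      (∃ u, p.r ≤ u ∧ u < s ∧ sent u = some p) ∨ ∃ u, p.r ≤ u ∧ u + B ≤ s ∧ u < s) :
    S.card ≤ 2 * ((Finset.range (N + 1)).filter busy).card := by
  set Q := S.filter fun p => ¬ busy (σ p) with hQ
  have hidle : ∀ p ∈ S, ¬ busy p.r → False := fun p hp hb => by
    have := hσ p hp
    rcases hserve p hp p.r le_rfl (by omega) hb with ⟨u, h₁, h₂, -⟩ | ⟨u, h₁, -, h₂⟩ <;> omega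
  have window : ∀ a t, a ≤ t → (∀ u, a ≤ u → u < t → busy u) → ¬ busy t →
      (Q.filter fun p => a ≤ p.r ∧ p.r < t).card ≤ t - a := by
    intro a t hat hrun ht
    have hmem : ∀ p ∈ Q.filter fun p => a ≤ p.r ∧ p.r < t,
        p ∈ S ∧ a ≤ p.r ∧ p.r < t ∧ t ≤ σ p := by
      intro p hp
      simp only [hQ, Finset.mem_filter] at hp
      obtain ⟨⟨hpS, hpb⟩, hap, hpt⟩ := hp
      refine ⟨hpS, hap, hpt, not_lt.1 fun hlt => hpb (hrun _ (hap.trans (hσ p hpS).1) hlt)⟩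
    by_cases hB : B ≤ t - a
    · refine le_trans (Finset.card_le_card fun p hp => ?_) ((hbuf t).trans hB)
      obtain ⟨h₁, h₂, h₃, h₄⟩ := hmem p hp
      simp only [Finset.mem_filter]
      exact ⟨h₁, h₃.le, h₄⟩
    · have hsent : ∀ p ∈ Q.filter fun p => a ≤ p.r ∧ p.r < t,
          ∃ u ∈ Finset.Ico a t, sent u = some p := by
        intro p hp
        obtain ⟨h₁, h₂, h₃, h₄⟩ := hmem p hp
        rcases hserve p h₁ t h₃.le (h₄.trans (hσ p h₁).2) ht with ⟨u, h₅, h₆, h₇⟩ | ⟨u, h₅, h₆, -⟩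
        · exact ⟨u, Finset.mem_Ico.2 ⟨h₂.trans h₅, h₆⟩, h₇⟩
        · omega
      choose! τ hτ hτs using hsent
      rw [← Nat.card_Ico a t]
      refine Finset.card_le_card_of_injOn τ hτ fun p hp q hq hpq => ?_
      have h₁ := hτs p hp
      have h₂ := hτs q hq
      rw [hpq, h₂] at h₁
      exact (Option.some.inj h₁).symm
  have before : ∀ t, ¬ busy t →
      (Q.filter fun p => p.r < t).card ≤ ((Finset.range t).filter busy).card := by
    intro t
    induction t using Nat.strong_induction_on with
    | _ t ih =>
      intro ht
      obtain ⟨a, hat, hrun, hstart⟩ := exists_maximal_run busy t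
      have hstart' : (Q.filter fun p => p.r < a).card ≤ ((Finset.range a).filter busy).card := by
        rcases hstart with rfl | ⟨b, rfl, hb⟩
        · simp
        · refine le_trans (Finset.card_le_card fun p hp => ?_) ((ih b (by omega) hb).trans
            (Finset.card_le_card (Finset.filter_subset_filter _
              (Finset.range_subset_range.2 (Nat.le_succ b)))))
          rw [Finset.mem_filter] at hp ⊢
          refine ⟨hp.1, lt_of_le_of_ne (by omega) fun h => ?_⟩
          exact hidle p (Finset.mem_filter.1 hp.1).1 (h ▸ hb)
      have hsplitQ : (Q.filter fun p => p.r < t) ⊆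
          (Q.filter fun p => p.r < a) ∪ Q.filter fun p => a ≤ p.r ∧ p.r < t := by
        intro p hp
        simp only [Finset.mem_union, Finset.mem_filter] at hp ⊢
        rcases lt_or_ge p.r a with h | h
        exacts [Or.inl ⟨hp.1, h⟩, Or.inr ⟨hp.1, h, hp.2⟩]
      have hsplitT : ((Finset.range a).filter busy) ∪ Finset.Ico a t ⊆
          (Finset.range t).filter busy := by
        intro u hu
        simp only [Finset.mem_union, Finset.mem_filter, Finset.mem_range, Finset.mem_Ico] at hu ⊢
        rcases hu with ⟨h₁, h₂⟩ | ⟨h₁, h₂⟩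
        exacts [⟨by omega, h₂⟩, ⟨h₂, hrun u h₁ h₂⟩]
      have hdisj : Disjoint ((Finset.range a).filter busy) (Finset.Ico a t) := by
        rw [Finset.disjoint_left]
        intro u hu hu'
        simp only [Finset.mem_filter, Finset.mem_range, Finset.mem_Ico] at hu hu'
        omega
      have h₁ := (Finset.card_le_card hsplitQ).trans (Finset.card_union_le _ _)
      have h₂ := Finset.card_le_card hsplitT
      rw [Finset.card_union_of_disjoint hdisj, Nat.card_Ico] at h₂
      have h₃ := window a t hat hrun ht
      omega
  have hQcard : Q.card ≤ ((Finset.range (N + 1)).filter busy).card := by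
    rcases Q.eq_empty_or_nonempty with h | h
    · simp [h]
    · obtain ⟨e, he, hemax⟩ := Finset.exists_max_image Q σ h
      obtain ⟨heS, heb⟩ := Finset.mem_filter.1 he
      have hlate : Q ⊆ Q.filter fun p => p.r < σ e := by
        intro p hp
        have hpS := (Finset.mem_filter.1 hp).1
        have hple := (hσ p hpS).1.trans (hemax p hp)
        exact Finset.mem_filter.2
          ⟨hp, lt_of_le_of_ne hple fun h => hidle p hpS (h ▸ heb)⟩
      refine (Finset.card_le_card hlate).trans ((before _ heb).trans
        (Finset.card_le_card (Finset.filter_subset_filter _ (Finset.range_subset_range.2 ?_))))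
      have := (hσ e heS).2.trans (hN e heS)
      omega
  have hbusy : (S.filter fun p => busy (σ p)).card ≤
      ((Finset.range (N + 1)).filter busy).card := by
    refine Finset.card_le_card_of_injOn σ (fun p hp => ?_) (hinj.mono fun p hp => ?_)
    · have hp := Finset.mem_filter.1 hp
      have := (hσ p hp.1).2.trans (hN p hp.1)
      exact Finset.mem_filter.2 ⟨Finset.mem_range.2 (by omega), hp.2⟩
    · exact (Finset.mem_filter.1 hp).1
  have hsplit : (S.filter fun p => busy (σ p)).card + Q.card = S.card := by
    rw [hQ]
    convert Finset.card_filter_add_card_filter_not (s := S) (fun p => busy (σ p))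
  omega

end Counting

section Buffer

variable {B : ℕ} {tie : Packet → Packet → Prop}

theorem ValOrder.le {p q : Packet} (h : ValOrder tie p q) : q.v ≤ p.v :=
  h.elim le_of_lt fun h => h.1.ge

theorem ValOrder.total [Std.Total tie] (p q : Packet) : ValOrder tie p q ∨ ValOrder tie q p := by
  rcases lt_trichotomy p.v q.v with h | h | h
  · exact Or.inr (Or.inl h)
  · exact (Std.Total.total (r := tie) p q).imp (fun ht => Or.inr ⟨h, ht⟩)
      fun ht => Or.inr ⟨h.symm, ht⟩
  · exact Or.inl (Or.inl h)

theorem ValOrder.trans [IsTrans Packet tie] {p q r : Packet} (h₁ : ValOrder tie p q)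
    (h₂ : ValOrder tie q r) : ValOrder tie p r := by
  rcases h₁ with h₁ | ⟨h₁, t₁⟩ <;> rcases h₂ with h₂ | ⟨h₂, t₂⟩
  · exact Or.inl (h₂.trans h₁)
  · exact Or.inl (h₂ ▸ h₁)
  · exact Or.inl (h₁ ▸ h₂)
  · exact Or.inr ⟨h₁.trans h₂, _root_.trans t₁ t₂⟩

/-- The number of packets of value at least `x` in a list. -/
noncomputable def countAbove (x : ℝ) (l : List Packet) : ℕ := l.countP fun p => x ≤ p.v

theorem countAbove_cons (x : ℝ) (p : Packet) (l : List Packet) :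
    countAbove x (p :: l) = countAbove x l + if x ≤ p.v then 1 else 0 := by
  simp [countAbove, List.countP_cons]

theorem countAbove_pos {x : ℝ} {p : Packet} {l : List Packet} (hp : p ∈ l) (hx : x ≤ p.v) :
    0 < countAbove x l :=
  List.countP_pos_iff.2 ⟨p, hp, by simpa using hx⟩

theorem countAbove_le_tail (x : ℝ) (l : List Packet) :
    countAbove x l ≤ countAbove x l.tail + 1 := by
  cases l with
  | nil => simp [countAbove]
  | cons p l => rw [countAbove_cons, List.tail_cons]; split_ifs <;> omega

theorem retain_sublist (B t i : ℕ) (l : List Packet) : (retain B t i l).Sublist l := by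
  induction l generalizing i with
  | nil => simp [retain]
  | cons p l ih =>
    rw [retain]
    split_ifs
    exacts [(ih _).cons_cons _, (ih _).cons _]

theorem retain_retain (B t i : ℕ) (l : List Packet) :
    retain B t i (retain B t i l) = retain B t i l := by
  induction l generalizing i with
  | nil => simp [retain]
  | cons p l ih =>
    rw [retain]
    split_ifs with h
    · rw [retain, if_pos h, ih]
    · exact ih i

theorem retain_cons_eq_self {B t i : ℕ} {p : Packet} {l : List Packet}
    (h : retain B t i (p :: l) = p :: l) :
    (i < B ∧ t + i ≤ p.d) ∧ retain B t (i + 1) l = l := by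
  rw [retain] at h
  split_ifs at h with hc
  · exact ⟨hc, (List.cons.inj h).2⟩
  · have := (retain_sublist B t i l).length_le
    rw [h, List.length_cons] at this
    omega

theorem retain_succ_time {B t i : ℕ} {l : List Packet} (h : retain B t (i + 1) l = l) :
    retain B (t + 1) i l = l := by
  induction l generalizing i with
  | nil => simp [retain]
  | cons p l ih =>
    obtain ⟨hc, hl⟩ := retain_cons_eq_self h
    rw [retain, if_pos ⟨by omega, by omega⟩, ih hl]

theorem countAbove_le_retain_shift (x : ℝ) {B t i : ℕ} {l : List Packet}
    (h : retain B t i l = l) : countAbove x l ≤ countAbove x (retain B t (i + 1) l) + 1 := by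
  induction l generalizing i with
  | nil => simp [countAbove]
  | cons p l ih =>
    obtain ⟨hc, hl⟩ := retain_cons_eq_self h
    have := ih hl
    rw [retain]
    split_ifs
    · rw [countAbove_cons, countAbove_cons]; omega
    · rw [hl, countAbove_cons]; split_ifs <;> omega

/-- Inserting a packet into a retained sorted list does not decrease the number of retained
packets above any value. -/
theorem countAbove_le_retain_orderedInsert (x : ℝ) {B t i : ℕ} {l : List Packet} (j : Packet)
    (hs : l.Pairwise (ValOrder tie)) (h : retain B t i l = l) :
    countAbove x l ≤ countAbove x (retain B t i (l.orderedInsert (ValOrder tie) j)) := by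
  induction l generalizing i with
  | nil => simp [countAbove]
  | cons p l ih =>
    obtain ⟨hc, hl⟩ := retain_cons_eq_self h
    rw [List.orderedInsert_cons]
    split_ifs with hj
    · rw [retain]
      split_ifs
      · have hshift := countAbove_le_retain_shift x h
        rw [countAbove_cons x j]
        split_ifs with hx
        · exact hshift
        · have hzero : countAbove x (p :: l) = 0 := by
            rw [countAbove, List.countP_eq_zero]
            intro q hq
            have hqp : q.v ≤ p.v := by
              rcases List.mem_cons.1 hq with rfl | hq
              exacts [le_rfl, ((List.pairwise_cons.1 hs).1 q hq).le]
            simpa using hqp.trans_lt (hj.le.trans_lt (not_le.1 hx))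
          omega
      · rw [h]
    · rw [retain, if_pos hc, countAbove_cons, countAbove_cons]
      have := ih (List.pairwise_cons.1 hs).2 hl
      omega

/-- A packet dropped from a sorted list is preceded by enough retained packets of at least its
value to fill the buffer or to exceed its deadline. -/
theorem mem_retain_or (x : ℝ) {B t i : ℕ} {l : List Packet} {p : Packet}
    (hs : l.Pairwise (ValOrder tie)) (hp : p ∈ l) (hx : x ≤ p.v) :
    p ∈ retain B t i l ∨ B ≤ i + countAbove x (retain B t i l) ∨
      p.d < t + i + countAbove x (retain B t i l) := by
  induction l generalizing i with
  | nil => simp at hp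
  | cons q l ih =>
    obtain ⟨hq, hs'⟩ := List.pairwise_cons.1 hs
    rw [retain]
    split_ifs with hc
    · rcases List.mem_cons.1 hp with rfl | hp
      · exact Or.inl List.mem_cons_self
      · rw [countAbove_cons, if_pos (hx.trans (hq p hp).le)]
        rcases ih (i := i + 1) hs' hp with h | h | h
        · exact Or.inl (List.mem_cons_of_mem _ h)
        · right; left; omega
        · right; right; omega
    · rcases List.mem_cons.1 hp with rfl | hp
      · right; omega
      · exact ih hs' hp

/-- The buffer contents between two operations of step `t`: sorted, and every packet meets
its tentative transmission time. -/
def Settled (B : ℕ) (tie : Packet → Packet → Prop) (t : ℕ) (l : List Packet) : Prop :=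
  l.Pairwise (ValOrder tie) ∧ retain B t 0 l = l

theorem Settled.tail {t : ℕ} {l : List Packet} (h : Settled B tie t l) :
    Settled B tie (t + 1) l.tail := by
  refine ⟨h.1.tail, ?_⟩
  cases l with
  | nil => simp [retain]
  | cons p l => exact retain_succ_time (retain_cons_eq_self h.2).2

theorem mem_of_mem_grqArrive {t : ℕ} {b A : List Packet} {p : Packet}
    (h : p ∈ grqArrive B tie t b A) : p ∈ b ∨ p ∈ A := by
  induction A generalizing b with
  | nil => exact Or.inl h
  | cons j A ih =>
    rcases ih (b := retain B t 0 (List.insertionSort (ValOrder tie) (j :: b))) h with h | h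
    · have := (retain_sublist _ _ _ _).subset h
      rw [List.mem_insertionSort, List.mem_cons] at this
      rcases this with rfl | this
      exacts [Or.inr List.mem_cons_self, Or.inl this]
    · exact Or.inr (List.mem_cons_of_mem _ h)

theorem grqArrive_spec [Std.Total tie] [IsTrans Packet tie] (x : ℝ) {t : ℕ} {b : List Packet}
    (A : List Packet) (hb : Settled B tie t b) :
    Settled B tie t (grqArrive B tie t b A) ∧
      countAbove x b ≤ countAbove x (grqArrive B tie t b A) ∧
      ∀ p, p ∈ b ∨ p ∈ A → x ≤ p.v → p ∈ grqArrive B tie t b A ∨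
        B ≤ countAbove x (grqArrive B tie t b A) ∨
        p.d < t + countAbove x (grqArrive B tie t b A) := by
  induction A generalizing b with
  | nil =>
    refine ⟨hb, le_rfl, fun p hp _ => Or.inl ?_⟩
    simpa [grqArrive] using hp
  | cons j A ih =>
    have : Std.Total (ValOrder tie) := ⟨ValOrder.total⟩
    have : IsTrans Packet (ValOrder tie) := ⟨fun _ _ _ => ValOrder.trans⟩
    set L := List.insertionSort (ValOrder tie) (j :: b) with hL
    have hLs : L.Pairwise (ValOrder tie) := List.pairwise_insertionSort _ _
    have hstep : Settled B tie t (retain B t 0 L) :=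
      ⟨hLs.sublist (retain_sublist _ _ _ _), retain_retain _ _ _ _⟩
    have hgrow : countAbove x b ≤ countAbove x (retain B t 0 L) := by
      rw [hL, List.insertionSort_cons, hb.1.insertionSort_eq]
      exact countAbove_le_retain_orderedInsert x j hb.1 hb.2
    obtain ⟨h₁, h₂, h₃⟩ := ih hstep
    refine ⟨h₁, hgrow.trans h₂, fun p hp hx => ?_⟩
    change p ∈ grqArrive B tie t (retain B t 0 L) A ∨
      B ≤ countAbove x (grqArrive B tie t (retain B t 0 L) A) ∨
      p.d < t + countAbove x (grqArrive B tie t (retain B t 0 L) A)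
    by_cases hpA : p ∈ A
    · exact h₃ p (Or.inr hpA) hx
    · have hpL : p ∈ L := by
        rw [hL, List.mem_insertionSort, List.mem_cons]
        simp only [List.mem_cons] at hp
        tauto
      rcases mem_retain_or (B := B) (t := t) (i := 0) x hLs hpL hx with h | h | h
      · exact h₃ p (Or.inl h) hx
      · right; left; omega
      · right; right; omega

end Buffer

section Run

variable {B : ℕ} {tie : Packet → Packet → Prop} {arr : ℕ → List Packet}

/-- The packets GRQ has carried over to the beginning of step `t`. -/
noncomputable def grqCarried (B : ℕ) (tie : Packet → Packet → Prop) (arr : ℕ → List Packet) :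
    ℕ → List Packet
  | 0 => []
  | t + 1 => (grqState B tie arr t).1

/-- The buffer of GRQ at step `t`, after the arrivals and before the transmission. -/
noncomputable def grqBuffer (B : ℕ) (tie : Packet → Packet → Prop) (arr : ℕ → List Packet)
    (t : ℕ) : List Packet :=
  grqArrive B tie t (grqCarried B tie arr t) (arr t)

theorem grqCarried_succ (t : ℕ) :
    grqCarried B tie arr (t + 1) = (grqBuffer B tie arr t).tail := by
  cases t <;> rfl

theorem sum_value_take_one (l : List Packet) :
    ((l.take 1).map Packet.v).sum = (l.head?.map Packet.v).getD 0 := by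
  cases l <;> simp

theorem sum_value_grqState (n : ℕ) :
    ((grqState B tie arr n).2.map Packet.v).sum =
      ∑ t ∈ Finset.range (n + 1), ((grqBuffer B tie arr t).head?.map Packet.v).getD 0 := by
  induction n with
  | zero =>
    rw [Finset.sum_range_one, ← sum_value_take_one]
    rfl
  | succ n ih =>
    rw [Finset.sum_range_succ, ← ih, ← sum_value_take_one, ← List.sum_append, ← List.map_append]
    rfl

theorem exists_mem_arr_of_mem_grqBuffer {t : ℕ} {p : Packet} (h : p ∈ grqBuffer B tie arr t) :
    ∃ s, p ∈ arr s := by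
  induction t with
  | zero =>
    rcases mem_of_mem_grqArrive h with h | h
    exacts [absurd h List.not_mem_nil, ⟨0, h⟩]
  | succ t ih =>
    rcases mem_of_mem_grqArrive h with h | h
    · rw [grqCarried_succ] at h
      exact ih (List.mem_of_mem_tail h)
    · exact ⟨_, h⟩

variable [Std.Total tie] [IsTrans Packet tie]

theorem settled_grqCarried (t : ℕ) : Settled B tie t (grqCarried B tie arr t) := by
  induction t with
  | zero => exact ⟨List.Pairwise.nil, rfl⟩
  | succ t ih =>
    rw [grqCarried_succ]
    exact (grqArrive_spec 0 (arr t) ih).1.tail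

theorem countAbove_grqBuffer_le_add (x : ℝ) (u k : ℕ) :
    countAbove x (grqBuffer B tie arr u) ≤ countAbove x (grqBuffer B tie arr (u + k)) + k := by
  induction k with
  | zero => rfl
  | succ k ih =>
    have h₁ := countAbove_le_tail x (grqBuffer B tie arr (u + k))
    have h₂ := (grqArrive_spec x (arr (u + k + 1))
      (settled_grqCarried (B := B) (tie := tie) (arr := arr) (u + k + 1))).2.1
    rw [grqCarried_succ] at h₂
    change _ ≤ countAbove x (grqArrive B tie (u + k + 1) (grqCarried B tie arr (u + k + 1))
      (arr (u + k + 1))) + (k + 1)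
    rw [grqCarried_succ]
    omega

/-- The fate of a packet under GRQ: it is stored, has been transmitted, or has been dropped. -/
theorem grqBuffer_fate (x : ℝ) {p : Packet} (hp : p ∈ arr p.r) (hx : x ≤ p.v) (k : ℕ) :
    p ∈ grqBuffer B tie arr (p.r + k) ∨
      (∃ u, p.r ≤ u ∧ u < p.r + k ∧ (grqBuffer B tie arr u).head? = some p) ∨
      ∃ u, p.r ≤ u ∧ u ≤ p.r + k ∧ (B ≤ countAbove x (grqBuffer B tie arr u) ∨
        p.d < u + countAbove x (grqBuffer B tie arr u)) := by
  induction k with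
  | zero =>
    exact ((grqArrive_spec x (arr p.r) (settled_grqCarried p.r)).2.2 p (Or.inr hp) hx).imp_right
      fun h => Or.inr ⟨p.r, le_rfl, le_rfl, h⟩
  | succ k ih =>
    rcases ih with h | ⟨u, h₁, h₂, h₃⟩ | ⟨u, h₁, h₂, h₃⟩
    · by_cases hhead : (grqBuffer B tie arr (p.r + k)).head? = some p
      · exact Or.inr (Or.inl ⟨_, by omega, by omega, hhead⟩)
      · have hmem : p ∈ grqCarried B tie arr (p.r + k + 1) := by
          rw [grqCarried_succ]
          revert h hhead
          cases grqBuffer B tie arr (p.r + k) with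
          | nil => simp
          | cons q l =>
            simp only [List.mem_cons, List.head?_cons, Option.some.injEq, List.tail_cons]
            rintro (rfl | h) hne
            exacts [absurd rfl hne, h]
        exact ((grqArrive_spec x (arr (p.r + k + 1)) (settled_grqCarried (p.r + k + 1))).2.2 p
          (Or.inl hmem) hx).imp_right fun h => Or.inr ⟨_, by omega, le_rfl, h⟩
    · exact Or.inr (Or.inl ⟨u, h₁, by omega, h₃⟩)
    · exact Or.inr (Or.inr ⟨u, h₁, by omega, h₃⟩)

theorem sent_or_full_of_idle (hB : 1 ≤ B) (x : ℝ) {p : Packet} (hp : p ∈ arr p.r)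
    (hx : x ≤ p.v) {s : ℕ} (hrs : p.r ≤ s) (hsd : s ≤ p.d)
    (hidle : ¬ 0 < countAbove x (grqBuffer B tie arr s)) :
    (∃ u, p.r ≤ u ∧ u < s ∧ (grqBuffer B tie arr u).head? = some p) ∨
      ∃ u, p.r ≤ u ∧ u + B ≤ s ∧ u < s := by
  obtain ⟨k, rfl⟩ := Nat.exists_eq_add_of_le hrs
  rcases grqBuffer_fate (B := B) (tie := tie) x hp hx k with h | h | ⟨u, h₁, h₂, h₃⟩
  · exact absurd (countAbove_pos h hx) hidle
  · exact Or.inl h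
  · obtain ⟨m, hm⟩ := Nat.exists_eq_add_of_le h₂
    have := countAbove_grqBuffer_le_add (B := B) (tie := tie) (arr := arr) x u m
    rw [← hm] at this
    exact Or.inr ⟨u, h₁, by omega, by omega⟩

theorem le_head_value_of_countAbove_pos {x : ℝ} {t : ℕ}
    (h : 0 < countAbove x (grqBuffer B tie arr t)) :
    x ≤ ((grqBuffer B tie arr t).head?.map Packet.v).getD 0 := by
  have hs : (grqBuffer B tie arr t).Pairwise (ValOrder tie) :=
    (grqArrive_spec x (arr t) (settled_grqCarried t)).1.1
  revert h hs
  cases grqBuffer B tie arr t with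
  | nil => simp [countAbove]
  | cons q l =>
    intro h hs
    obtain ⟨p, hp, hx⟩ := List.countP_pos_iff.1 h
    have hx : x ≤ p.v := by simpa using hx
    rcases List.mem_cons.1 hp with rfl | hp
    · simpa using hx
    · simpa using hx.trans ((List.pairwise_cons.1 hs).1 p hp).le

end Run

theorem grq_two_competitive (B : ℕ) (hB : 1 ≤ B) (P : Finset Packet)
    (hP : ∀ p ∈ P, p.r ≤ p.d ∧ 0 ≤ p.v)
    (tie : Packet → Packet → Prop) (htie : IsLinearOrder Packet tie)
    (arr : ℕ → List Packet)
    (harr : ∀ t : ℕ, (arr t).Nodup ∧ (arr t).toFinset = P.filter (fun p => p.r = t)) :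
    ∀ S ⊆ P, Feasible B S →
      totalValue S ≤
        2 * (((grqState B tie arr (P.sup Packet.d)).2.map Packet.v).sum) := by
  rintro S hS ⟨σ, hinj, hσ, hbuf⟩
  have hmem : ∀ t p, p ∈ arr t ↔ p ∈ P ∧ p.r = t := fun t p => by
    rw [← List.mem_toFinset, (harr t).2, Finset.mem_filter]
  set w : ℕ → ℝ := fun t => ((grqBuffer B tie arr t).head?.map Packet.v).getD 0 with hw
  have hw0 : ∀ t, 0 ≤ w t := by
    intro t
    simp only [hw]
    cases hh : (grqBuffer B tie arr t).head? with
    | none => simp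
    | some p =>
      obtain ⟨s, hs⟩ := exists_mem_arr_of_mem_grqBuffer (List.mem_of_mem_head? hh)
      simpa using (hP p ((hmem s p).1 hs).1).2
  set N := P.sup Packet.d
  have hlevel : ∀ x : ℝ, (S.filter fun p => x ≤ p.v).card ≤
      (((Finset.range (N + 1)) ×ˢ (Finset.univ : Finset Bool)).filter fun q => x ≤ w q.1).card := by
    intro x
    have hsub : S.filter (fun p => x ≤ p.v) ⊆ S := Finset.filter_subset _ _
    have hcard := card_le_two_mul_card_busy (N := N) (hinj.mono (Finset.coe_subset.2 hsub))
      (fun p hp => hσ p (hsub hp))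
      (fun t => (Finset.card_le_card (Finset.filter_subset_filter _ hsub)).trans (hbuf t))
      (fun p hp => Finset.le_sup (f := Packet.d) (hS (hsub hp)))
      (fun t => 0 < countAbove x (grqBuffer B tie arr t))
      (fun t => (grqBuffer B tie arr t).head?)
      (fun p hp s h₁ h₂ h₃ => sent_or_full_of_idle hB x ((hmem _ p).2 ⟨hS (hsub hp), rfl⟩)
        (Finset.mem_filter.1 hp).2 h₁ h₂ h₃)
    refine hcard.trans ?_
    rw [Finset.filter_product_left (fun t => x ≤ w t), Finset.card_product, Finset.card_univ,
      Fintype.card_bool, mul_comm]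
    refine Nat.mul_le_mul_right 2 (Finset.card_le_card fun t ht => ?_)
    rw [Finset.mem_filter] at ht ⊢
    exact ⟨ht.1, le_head_value_of_countAbove_pos ht.2⟩
  have hsum := sum_le_sum_of_card_superlevel_le S _ Packet.v _ (fun q _ => hw0 q.1) hlevel
  rw [Finset.sum_product] at hsum
  rw [totalValue, sum_value_grqState, Finset.mul_sum]
  simpa [two_mul] using hsum
end

section
/- Let B ≥ 2 be an integer and let c be a real number with c < 2 − 1/B. Then there exists ε > 0 such that in the instance I(B,ε): (i) there is a B-feasible subset of total value (1+ε)B + (B−1); (ii) every B-feasible subset containing none of the packets of value 1 has total value at most (1+ε)B; and (iii) (1+ε)B + (B−1) > c · (1+ε)B. Consequently, the maximum total value of a B-feasible subset of I(B,ε) exceeds c times the maximum total value of a B-feasible subset of I(B,ε) that contains no packet of value 1. -/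
attribute [local instance] Classical.propDecidable

/-- The packet `q_i`: release time 1, deadline `B + i`, value 1. -/
def qpkt (B i : ℕ) : Packet := ⟨1, B + i, 1⟩

/-- The packet `p_i`: release time 1, deadline `i`, value `1 + ε`. -/
noncomputable def ppkt (ε : ℝ) (i : ℕ) : Packet := ⟨1, i, 1 + ε⟩

/-- The packet `p'_i`: release time `i`, deadline `i`, value `1 + ε`. -/
noncomputable def p'pkt (ε : ℝ) (i : ℕ) : Packet := ⟨i, i, 1 + ε⟩

/-- The lower-bound instance `I(B, ε)`: packets `q_1, …, q_B`, `p_1, …, p_B`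
and `p'_2, …, p'_B`. -/
noncomputable def InstI (B : ℕ) (ε : ℝ) : Finset Packet :=
  (Finset.Icc 1 B).image (qpkt B) ∪ (Finset.Icc 1 B).image (ppkt ε) ∪
    (Finset.Icc 2 B).image (p'pkt ε)

theorem p'pkt_injective (ε : ℝ) : Function.Injective (p'pkt ε) := fun _ _ h =>
  congrArg Packet.d h

theorem qpkt_injective (B : ℕ) : Function.Injective (qpkt B) := fun _ _ h =>
  Nat.add_left_cancel (congrArg Packet.d h)

/-- The optimal schedule's packets: `p_1 = p'_1`, `p'_2, …, p'_B` and `q_1, …, q_{B-1}`. -/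
noncomputable def optSet (B : ℕ) (ε : ℝ) : Finset Packet :=
  (Finset.Icc 1 B).image (p'pkt ε) ∪ (Finset.Icc 1 (B - 1)).image (qpkt B)

theorem mem_optSet {B : ℕ} {ε : ℝ} {p : Packet} :
    p ∈ optSet B ε ↔ (∃ i, (1 ≤ i ∧ i ≤ B) ∧ p'pkt ε i = p) ∨
      ∃ i, (1 ≤ i ∧ i ≤ B - 1) ∧ qpkt B i = p := by
  simp only [optSet, Finset.mem_union, Finset.mem_image, Finset.mem_Icc]

theorem optSet_subset (B : ℕ) (ε : ℝ) : optSet B ε ⊆ InstI B ε := by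
  intro p hp
  simp only [InstI, Finset.mem_union, Finset.mem_image, Finset.mem_Icc]
  rcases mem_optSet.1 hp with ⟨i, hi, rfl⟩ | ⟨i, hi, rfl⟩
  · rcases hi.1.eq_or_lt with rfl | h
    · exact Or.inl (Or.inr ⟨1, hi, rfl⟩)
    · exact Or.inr ⟨i, ⟨h, hi.2⟩, rfl⟩
  · exact Or.inl (Or.inl ⟨i, ⟨hi.1, by omega⟩, rfl⟩)

/-- Transmitting every packet of `optSet` at its deadline is a valid schedule. -/
theorem feasible_optSet {B : ℕ} (hB : 1 ≤ B) (ε : ℝ) : Feasible B (optSet B ε) := by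
  refine ⟨Packet.d, ?_, ?_, ?_⟩
  · intro p hp q hq h
    rcases mem_optSet.1 hp with ⟨i, hi, rfl⟩ | ⟨i, hi, rfl⟩ <;>
      rcases mem_optSet.1 hq with ⟨j, hj, rfl⟩ | ⟨j, hj, rfl⟩ <;>
      simp only [p'pkt, qpkt] at h
    · rw [h]
    · omega
    · omega
    · rw [Nat.add_left_cancel h]
  · intro p hp
    refine ⟨?_, le_rfl⟩
    rcases mem_optSet.1 hp with ⟨i, hi, rfl⟩ | ⟨i, hi, rfl⟩
    · exact le_rfl
    · simp only [qpkt]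
      omega
  · intro t
    have hsub : (optSet B ε).filter (fun p => p.r ≤ t ∧ t ≤ p.d) ⊆
        insert (p'pkt ε t) ((Finset.Icc 1 (B - 1)).image (qpkt B)) := by
      intro p hp
      obtain ⟨hp, ht⟩ := Finset.mem_filter.1 hp
      rcases mem_optSet.1 hp with ⟨i, hi, rfl⟩ | ⟨i, hi, rfl⟩
      · have : i = t := le_antisymm ht.1 ht.2
        rw [this]
        exact Finset.mem_insert_self _ _
      · exact Finset.mem_insert_of_mem (Finset.mem_image_of_mem _ (Finset.mem_Icc.2 hi))
    calc _ ≤ _ := Finset.card_le_card hsub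
      _ ≤ ((Finset.Icc 1 (B - 1)).image (qpkt B)).card + 1 := Finset.card_insert_le _ _
      _ ≤ (Finset.Icc 1 (B - 1)).card + 1 := Nat.add_le_add_right Finset.card_image_le 1
      _ = B := by
        rw [Nat.card_Icc]
        omega

theorem totalValue_optSet {B : ℕ} (hB : 1 ≤ B) (ε : ℝ) :
    totalValue (optSet B ε) = (1 + ε) * B + ((B : ℝ) - 1) := by
  have hdisj : Disjoint ((Finset.Icc 1 B).image (p'pkt ε))
      ((Finset.Icc 1 (B - 1)).image (qpkt B)) := by
    rw [Finset.disjoint_left]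
    intro p hp hq
    simp only [Finset.mem_image, Finset.mem_Icc] at hp hq
    obtain ⟨i, hi, rfl⟩ := hp
    obtain ⟨j, hj, h⟩ := hq
    have := congrArg Packet.d h
    simp only [qpkt, p'pkt] at this
    omega
  rw [totalValue, optSet, Finset.sum_union hdisj,
    Finset.sum_image (p'pkt_injective ε).injOn, Finset.sum_image (qpkt_injective B).injOn]
  simp only [p'pkt, qpkt, Finset.sum_const, Nat.card_Icc, nsmul_eq_mul, Nat.add_sub_cancel,
    Nat.cast_sub hB, Nat.cast_one]
  ring

theorem deadline_le_and_value_of_mem_InstI {B : ℕ} {ε : ℝ} {p : Packet} (hp : p ∈ InstI B ε)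
    (hq : ∀ i ∈ Finset.Icc 1 B, qpkt B i ≠ p) : 1 ≤ p.r ∧ p.d ≤ B ∧ p.v = 1 + ε := by
  simp only [InstI, Finset.mem_union, Finset.mem_image] at hp
  rcases hp with (⟨i, hi, rfl⟩ | ⟨i, hi, rfl⟩) | ⟨i, hi, rfl⟩
  · exact absurd rfl (hq i hi)
  · exact ⟨le_rfl, (Finset.mem_Icc.1 hi).2, rfl⟩
  · rw [Finset.mem_Icc] at hi
    exact ⟨by simp only [p'pkt]; omega, hi.2, rfl⟩

theorem Feasible.card_le {B D : ℕ} {S : Finset Packet} (h : Feasible B S)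
    (hS : ∀ p ∈ S, 1 ≤ p.r ∧ p.d ≤ D) : S.card ≤ D := by
  obtain ⟨σ, hinj, hσ, -⟩ := h
  have hmaps : Set.MapsTo σ ↑S ↑(Finset.Icc 1 D) := fun p hp =>
    Finset.mem_coe.2 (Finset.mem_Icc.2
      ⟨(hS p hp).1.trans (hσ p hp).1, (hσ p hp).2.trans (hS p hp).2⟩)
  simpa using Finset.card_le_card_of_injOn σ hmaps hinj

theorem totalValue_of_no_qpkt {B : ℕ} {ε : ℝ} {S : Finset Packet} (hS : S ⊆ InstI B ε)
    (hq : ∀ i ∈ Finset.Icc 1 B, qpkt B i ∉ S) : totalValue S = (1 + ε) * S.card := by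
  have hv : ∀ p ∈ S, p.v = 1 + ε := fun p hp =>
    (deadline_le_and_value_of_mem_InstI (hS hp) fun i hi h => hq i hi (h ▸ hp)).2.2
  rw [totalValue, Finset.sum_congr rfl hv, Finset.sum_const, nsmul_eq_mul, mul_comm]

theorem totalValue_le_of_no_qpkt {B : ℕ} {ε : ℝ} (hε : 0 ≤ 1 + ε) {S : Finset Packet}
    (hS : S ⊆ InstI B ε) (hf : Feasible B S) (hq : ∀ i ∈ Finset.Icc 1 B, qpkt B i ∉ S) :
    totalValue S ≤ (1 + ε) * B := by
  rw [totalValue_of_no_qpkt hS hq]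
  refine mul_le_mul_of_nonneg_left (Nat.cast_le.2 (hf.card_le fun p hp => ?_)) hε
  have := deadline_le_and_value_of_mem_InstI (hS hp) fun i hi h => hq i hi (h ▸ hp)
  exact ⟨this.1, this.2.1⟩

theorem lower_bound_instance (B : ℕ) (hB : 2 ≤ B) (c : ℝ) (hc : c < 2 - 1 / B) :
    ∃ ε : ℝ, 0 < ε ∧
      -- (i) a B-feasible subset of total value (1+ε)B + (B−1)
      (∃ S ⊆ InstI B ε, Feasible B S ∧ totalValue S = (1 + ε) * B + ((B : ℝ) - 1)) ∧
      -- (ii) every B-feasible subset containing none of the value-1 packets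
      --      has total value at most (1+ε)B
      (∀ S ⊆ InstI B ε, Feasible B S → (∀ i ∈ Finset.Icc 1 B, qpkt B i ∉ S) →
        totalValue S ≤ (1 + ε) * B) ∧
      -- (iii)
      ((1 + ε) * B + ((B : ℝ) - 1) > c * ((1 + ε) * B)) ∧
      -- consequence: the optimum exceeds c times the best value-1-free feasible value
      (∃ S ⊆ InstI B ε, Feasible B S ∧
        ∀ T ⊆ InstI B ε, Feasible B T → (∀ i ∈ Finset.Icc 1 B, qpkt B i ∉ T) →
          c * totalValue T < totalValue S) := by
  have hB1 : 1 ≤ B := by omega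
  have hBR : (1 : ℝ) ≤ B := by exact_mod_cast hB1
  have hB0 : (0 : ℝ) < B := by linarith
  obtain ⟨ε, hε⟩ : ∃ ε : ℝ, ε = 2 - 1 / B - c := ⟨_, rfl⟩
  have hε0 : 0 < ε := by linarith
  have hBε : ε * B = 2 * B - 1 - c * B := by
    rw [hε]
    field_simp
  have hc2 : c < 2 := by
    have : (0 : ℝ) < 1 / B := by positivity
    linarith
  have hgap : c * ((1 + ε) * B) < (1 + ε) * B + ((B : ℝ) - 1) := by
    nlinarith [mul_pos (mul_pos hε0 hB0) (sub_pos.2 hc2)]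
  have hle := fun S hS hf hq =>
    totalValue_le_of_no_qpkt (B := B) (ε := ε) (by linarith) (S := S) hS hf hq
  have hopt := totalValue_optSet hB1 ε
  refine ⟨ε, hε0, ⟨_, optSet_subset B ε, feasible_optSet hB1 ε, hopt⟩, hle, hgap,
    _, optSet_subset B ε, feasible_optSet hB1 ε, fun T hT hf hq => ?_⟩
  rw [hopt]
  rcases le_or_gt 0 c with h | h
  · exact (mul_le_mul_of_nonneg_left (hle T hT hf hq) h).trans_lt hgap
  · have hT0 : 0 ≤ totalValue T := by
      rw [totalValue_of_no_qpkt hT hq]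
      positivity
    have hpos : 0 < (1 + ε) * B := by positivity
    linarith [mul_nonpos_of_nonpos_of_nonneg h.le hT0]
end

section
/- Let S be a finite set of packets and B ≥ 1 a buffer size. Then S is B-feasible if and only if the EDF schedule of S assigns to every packet p ∈ S a transmission time σ_EDF(p) with σ_EDF(p) ≤ d_p, and for every time t ∈ ℕ the number of packets p ∈ S with r_p ≤ t ≤ σ_EDF(p) is at most B. -/
attribute [local instance] Classical.propDecidable

/-- `sched` is an EDF schedule of the finite set `S` of packets: at each time
`t = 0, 1, 2, …`, among the packets `p ∈ S` with `r_p ≤ t ≤ d_p` that have not yet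
been assigned a transmission time, it transmits one with the smallest deadline
(ties broken arbitrarily, e.g. by a fixed linear order on packets), and it
transmits nothing iff no such packet exists. -/
def IsEDFSched (S : Finset Packet) (sched : ℕ → Option Packet) : Prop :=
  ∀ t : ℕ,
    (∀ p : Packet, sched t = some p →
      p ∈ S ∧ p.r ≤ t ∧ t ≤ p.d ∧ (∀ s < t, sched s ≠ some p) ∧
        ∀ q ∈ S, q.r ≤ t → t ≤ q.d → (∀ s < t, sched s ≠ some q) → p.d ≤ q.d) ∧
    (sched t = none →
      ∀ q ∈ S, ¬(q.r ≤ t ∧ t ≤ q.d ∧ ∀ s < t, sched s ≠ some q))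

/-- A packet of smallest deadline in `A`, if there is one. -/
noncomputable def earliestDeadline (A : Finset Packet) : Option Packet :=
  if h : A.Nonempty then some (A.exists_min_image Packet.d h).choose else none

theorem earliestDeadline_eq_some {A : Finset Packet} {p : Packet}
    (h : earliestDeadline A = some p) : p ∈ A ∧ ∀ q ∈ A, p.d ≤ q.d := by
  unfold earliestDeadline at h
  split_ifs at h with hA
  obtain rfl := Option.some.inj h
  exact (A.exists_min_image Packet.d hA).choose_spec

theorem earliestDeadline_eq_none {A : Finset Packet} (h : earliestDeadline A = none) :
    A = ∅ := by
  unfold earliestDeadline at h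
  split_ifs at h with hA
  exact Finset.not_nonempty_iff_eq_empty.mp hA

/-- The packets of `S` that may be transmitted at time `t` when those in `D` already were. -/
noncomputable def available (S : Finset Packet) (t : ℕ) (D : Finset Packet) : Finset Packet :=
  S.filter fun p => p.r ≤ t ∧ t ≤ p.d ∧ p ∉ D

/-- The packets transmitted before time `t` by the schedule `edfSched S`. -/
noncomputable def edfDone (S : Finset Packet) : ℕ → Finset Packet
  | 0 => ∅
  | t + 1 => edfDone S t ∪ (earliestDeadline (available S t (edfDone S t))).toFinset

/-- An EDF schedule of `S`. -/
noncomputable def edfSched (S : Finset Packet) (t : ℕ) : Option Packet :=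
  earliestDeadline (available S t (edfDone S t))

theorem mem_edfDone {S : Finset Packet} {p : Packet} {t : ℕ} :
    p ∈ edfDone S t ↔ ∃ s < t, edfSched S s = some p := by
  induction t with
  | zero => simp [edfDone]
  | succ t ih =>
    rw [Nat.exists_lt_succ_right, ← ih]
    simp [edfDone, edfSched]

theorem mem_available_edfDone {S : Finset Packet} {p : Packet} {t : ℕ} :
    p ∈ available S t (edfDone S t) ↔
      p ∈ S ∧ p.r ≤ t ∧ t ≤ p.d ∧ ∀ s < t, edfSched S s ≠ some p := by
  simp [available, mem_edfDone]

theorem isEDFSched_edfSched (S : Finset Packet) : IsEDFSched S (edfSched S) := by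
  refine fun t => ⟨fun p hp => ?_, fun hn q hq h => ?_⟩
  · obtain ⟨hmem, hmin⟩ := earliestDeadline_eq_some hp
    obtain ⟨h1, h2, h3, h4⟩ := mem_available_edfDone.mp hmem
    exact ⟨h1, h2, h3, h4, fun q hq hr hd hs =>
      hmin q (mem_available_edfDone.mpr ⟨hq, hr, hd, hs⟩)⟩
  · have hmem := mem_available_edfDone.mpr ⟨hq, h⟩
    rw [earliestDeadline_eq_none hn] at hmem
    exact absurd hmem (Finset.notMem_empty q)

theorem IsEDFSched.time_unique {S : Finset Packet} {sched : ℕ → Option Packet}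
    (h : IsEDFSched S sched) {p : Packet} {s t : ℕ} (hs : sched s = some p)
    (ht : sched t = some p) : s = t := by
  rcases lt_trichotomy s t with hst | hst | hst
  · exact absurd hs (((h t).1 p ht).2.2.2.1 s hst)
  · exact hst
  · exact absurd ht (((h s).1 p hs).2.2.2.1 t hst)

/-- `σ` witnesses that `S` is `B`-feasible. -/
def IsFeasibleSched (B : ℕ) (S : Finset Packet) (σ : Packet → ℕ) : Prop :=
  Set.InjOn σ ↑S ∧ (∀ p ∈ S, p.r ≤ σ p ∧ σ p ≤ p.d) ∧
    ∀ t : ℕ, (S.filter fun p => p.r ≤ t ∧ t ≤ σ p).card ≤ B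

/-- Transmitting `p` already at time `t`, in exchange with the packet transmitted then (if any),
keeps a schedule feasible provided that packet has no earlier deadline than `p`. -/
theorem IsFeasibleSched.swap {B : ℕ} {S : Finset Packet} {σ : Packet → ℕ}
    (h : IsFeasibleSched B S σ) {p : Packet} (hp : p ∈ S) {t : ℕ} (hr : p.r ≤ t)
    (ht : t ≤ σ p) (hd : ∀ q ∈ S, σ q = t → p.d ≤ q.d) :
    IsFeasibleSched B S fun x => Equiv.swap t (σ p) (σ x) := by
  obtain ⟨hinj, hwin, hbuf⟩ := h
  have hself : Equiv.swap t (σ p) (σ p) = t := Equiv.swap_apply_right _ _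
  have hoth : ∀ x ∈ S, x ≠ p → σ x ≠ t → Equiv.swap t (σ p) (σ x) = σ x := fun x hx hxp hxt =>
    Equiv.swap_apply_of_ne_of_ne hxt fun he => hxp (hinj hx hp he)
  refine ⟨(Equiv.injective _).comp_injOn hinj, fun x hx => ?_, fun u => ?_⟩
  · have hwx := hwin x hx
    by_cases hxp : x = p
    · subst hxp
      simp only [hself]
      omega
    by_cases hxt : σ x = t
    · have := hd x hx hxt
      have := hwin p hp
      simp only [hxt, Equiv.swap_apply_left]
      omega
    · simpa only [hoth x hx hxp hxt] using hwx
  · refine le_trans ?_ (hbuf u)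
    by_cases hq : u ≤ t ∨ ∀ q ∈ S, σ q ≠ t
    · refine Finset.card_le_card fun x => ?_
      simp only [Finset.mem_filter]
      rintro ⟨hx, hxr, hxu⟩
      refine ⟨hx, hxr, ?_⟩
      by_cases hxp : x = p
      · subst hxp
        rw [hself] at hxu
        omega
      by_cases hxt : σ x = t
      · exact hxt ▸ hq.resolve_right fun h => h x hx hxt
      · rwa [hoth x hx hxp hxt] at hxu
    · push Not at hq
      obtain ⟨hu, q, hqS, hqt⟩ := hq
      refine Finset.card_le_card_of_injOn (Equiv.swap p q) (fun x => ?_)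
        (Equiv.injective _).injOn
      simp only [Finset.coe_filter, Set.mem_ofPred_eq]
      rintro ⟨hx, hxr, hxu⟩
      have hxp : x ≠ p := by
        rintro rfl
        rw [hself] at hxu
        omega
      by_cases hxq : x = q
      · subst hxq
        rw [hqt, Equiv.swap_apply_left] at hxu
        rw [Equiv.swap_apply_right]
        exact ⟨hp, by omega, hxu⟩
      · rw [Equiv.swap_apply_of_ne_of_ne hxp hxq]
        rw [hoth x hx hxp fun he => hxq (hinj hx hqS (he.trans hqt.symm))] at hxu
        exact ⟨hx, hxr, hxu⟩

/-- A feasible schedule can be made to agree with an EDF schedule on any initial time segment. -/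
theorem IsFeasibleSched.exists_agree {B : ℕ} {S : Finset Packet} {σ₀ : Packet → ℕ}
    (h₀ : IsFeasibleSched B S σ₀) {sched : ℕ → Option Packet} (hE : IsEDFSched S sched) (t : ℕ) :
    ∃ σ, IsFeasibleSched B S σ ∧ ∀ s < t, ∀ p ∈ S, σ p = s ↔ sched s = some p := by
  induction t with
  | zero => exact ⟨σ₀, h₀, by simp⟩
  | succ t ih =>
    obtain ⟨σ, hσ, hag⟩ := ih
    have havail : ∀ q ∈ S, σ q = t → q.r ≤ t ∧ t ≤ q.d ∧ ∀ s < t, sched s ≠ some q :=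
      fun q hq hqt => ⟨hqt ▸ (hσ.2.1 q hq).1, hqt ▸ (hσ.2.1 q hq).2, fun s hs he =>
        hs.ne' (hqt.symm.trans ((hag s hs q hq).mpr he))⟩
    cases hst : sched t with
    | none =>
      refine ⟨σ, hσ, fun s hs p hp => ?_⟩
      rcases Nat.lt_succ_iff_lt_or_eq.mp hs with hs | rfl
      · exact hag s hs p hp
      · simpa [hst] using fun he => (hE s).2 hst p hp (havail p hp he)
    | some p =>
      obtain ⟨hp, hr, -, hnew, hmin⟩ := (hE t).1 p hst
      have ht : t ≤ σ p := by
        by_contra! hlt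
        exact hnew _ hlt ((hag _ hlt p hp).mp rfl)
      refine ⟨_, hσ.swap hp hr ht fun q hq hqt => ?_, fun s hs x hx => ?_⟩
      · obtain ⟨h1, h2, h3⟩ := havail q hq hqt
        exact hmin q hq h1 h2 h3
      · rw [← Equiv.eq_symm_apply, Equiv.symm_swap]
        rcases Nat.lt_succ_iff_lt_or_eq.mp hs with hs | rfl
        · rw [Equiv.swap_apply_of_ne_of_ne hs.ne (hs.trans_le ht).ne, hag s hs x hx]
        · rw [Equiv.swap_apply_left, hst, Option.some.injEq]
          exact ⟨fun he => (hσ.1 hx hp he).symm, fun he => he ▸ rfl⟩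

theorem feasible_iff_edf_succeeds (B : ℕ) (hB : 1 ≤ B) (S : Finset Packet)
    (hS : ∀ p ∈ S, p.r ≤ p.d ∧ 0 ≤ p.v) :
    Feasible B S ↔
      ∀ sched : ℕ → Option Packet, IsEDFSched S sched →
        -- every packet of S is transmitted by its deadline, and
        (∀ p ∈ S, ∃ s : ℕ, s ≤ p.d ∧ sched s = some p) ∧
        -- at every time, at most B packets are stored
        (∀ t : ℕ,
          (S.filter fun p => p.r ≤ t ∧ ∃ s : ℕ, t ≤ s ∧ sched s = some p).card ≤ B) := by
  constructor
  · rintro ⟨σ₀, h₀⟩ sched hE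
    obtain ⟨σ, hσ, hag⟩ := IsFeasibleSched.exists_agree h₀ hE (S.sup Packet.d + 1)
    have hsched : ∀ p ∈ S, sched (σ p) = some p := fun p hp =>
      (hag _ (Nat.lt_succ_of_le ((hσ.2.1 p hp).2.trans (Finset.le_sup hp))) p hp).mp rfl
    refine ⟨fun p hp => ⟨σ p, (hσ.2.1 p hp).2, hsched p hp⟩, fun t => ?_⟩
    refine (Finset.card_le_card fun p => ?_).trans (hσ.2.2 t)
    simp only [Finset.mem_filter]
    rintro ⟨hp, hr, s, hts, hs⟩
    exact ⟨hp, hr, hE.time_unique hs (hsched p hp) ▸ hts⟩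
  · intro h
    have hE := isEDFSched_edfSched S
    obtain ⟨hall, hbuf⟩ := h _ hE
    choose! σ hd hσ using hall
    refine ⟨σ, fun p hp q hq he => ?_, fun p hp => ⟨((hE _).1 p (hσ p hp)).2.1, hd p hp⟩,
      fun t => ?_⟩
    · exact Option.some.inj ((hσ p hp).symm.trans (he ▸ hσ q hq))
    · refine (Finset.card_le_card fun p => ?_).trans (hbuf t)
      simp only [Finset.mem_filter]
      rintro ⟨hp, hr, ht⟩
      exact ⟨hp, hr, σ p, ht, hσ p hp⟩
end

section
/- Let S be a finite set of packets that admits an injective function σ : S → ℕ with r_p ≤ σ(p) ≤ d_p for every p ∈ S. Then the EDF schedule of S assigns to every packet p ∈ S a transmission time σ_EDF(p) ≤ d_p, and for every time t ∈ ℕ, the number of packets p ∈ S with r_p ≤ t ≤ σ_EDF(p) is at most the number of packets p ∈ S with r_p ≤ t ≤ σ(p). In particular, if σ witnesses B-feasibility of S for some B ≥ 1, then so does σ_EDF. -/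
attribute [local instance] Classical.propDecidable

/-- Exchange argument: for every horizon `t`, a feasible assignment `σ` can be turned into one that
agrees with the EDF schedule before time `t` without increasing the buffer load at any time. -/
theorem IsEDFSched.exists_agreeing_assignment {S : Finset Packet} {σ : Packet → ℕ}
    (hinj : Set.InjOn σ ↑S) (hwin : ∀ p ∈ S, p.r ≤ σ p ∧ σ p ≤ p.d)
    {sched : ℕ → Option Packet} (h : IsEDFSched S sched) (t : ℕ) :
    ∃ τ : Packet → ℕ, Set.InjOn τ ↑S ∧ (∀ p ∈ S, p.r ≤ τ p ∧ τ p ≤ p.d) ∧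
      (∀ p ∈ S, ∀ s < t, sched s = some p ↔ τ p = s) ∧
      ∀ u : ℕ, (S.filter fun p => p.r ≤ u ∧ u ≤ τ p).card ≤
        (S.filter fun p => p.r ≤ u ∧ u ≤ σ p).card := by
  induction t with
  | zero => exact ⟨σ, hinj, hwin, by simp, fun u => le_rfl⟩
  | succ t ih =>
    obtain ⟨τ, τinj, τwin, τagree, τload⟩ := ih
    have unsent : ∀ x ∈ S, t ≤ τ x → ∀ s < t, sched s ≠ some x := by
      intro x hx htx s hs hsx
      have := (τagree x hx s hs).1 hsx
      omega
    obtain ⟨hsome, hnone⟩ := h t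
    cases hst : sched t with
    | none =>
      refine ⟨τ, τinj, τwin, fun x hx s hs => ?_, τload⟩
      rcases Nat.lt_succ_iff_lt_or_eq.1 hs with hs | rfl
      · exact τagree x hx s hs
      · rw [hst]
        refine ⟨fun h => by simp at h, fun hxs => ?_⟩
        have hw := τwin x hx
        exact absurd ⟨by omega, by omega, unsent x hx hxs.ge⟩ (hnone hst x hx)
    | some p =>
      obtain ⟨hpS, hpr, hpd, hpu, hmin⟩ := hsome p hst
      have hpτ : t ≤ τ p := by
        by_contra! hlt
        exact hpu _ hlt ((τagree p hpS _ hlt).2 rfl)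
      have hτ' : ∀ x, Equiv.swap t (τ p) (τ x) =
          if τ x = t then τ p else if τ x = τ p then t else τ x :=
        fun x => Equiv.swap_apply_def _ _ _
      refine ⟨fun x => Equiv.swap t (τ p) (τ x), ?_, ?_, ?_, ?_⟩
      · exact fun x hx y hy hxy => τinj hx hy ((Equiv.swap t (τ p)).injective hxy)
      · intro x hx
        have hw := τwin x hx
        have hwp := τwin p hpS
        simp only [hτ']
        split_ifs with h1 h2
        · have := hmin x hx (by omega) (by omega) (unsent x hx h1.ge)
          omega
        · obtain rfl := τinj hx hpS h2
          exact ⟨hpr, hpd⟩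
        · exact hw
      · intro x hx s hs
        simp only [hτ']
        rcases Nat.lt_succ_iff_lt_or_eq.1 hs with hs | rfl
        · rw [τagree x hx s hs]
          split_ifs <;> omega
        · rw [hst, Option.some_inj]
          constructor
          · rintro rfl
            split_ifs <;> omega
          · intro hxs
            refine (τinj hx hpS ?_).symm
            split_ifs at hxs <;> omega
      · intro u
        refine le_trans ?_ (τload u)
        rcases le_or_gt u t with hu | hu
        · refine Finset.card_le_card fun x => ?_
          simp only [Finset.mem_filter, hτ']
          rintro ⟨hx, hxr, hxu⟩
          refine ⟨hx, hxr, ?_⟩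
          split_ifs at hxu <;> omega
        · refine Finset.card_le_card_of_injOn (fun x => if τ x = t then p else x) ?_ ?_
          · intro x
            simp only [Finset.coe_filter, Set.mem_ofPred_eq, hτ']
            rintro ⟨hx, hxr, hxu⟩
            split_ifs at hxu ⊢
            · exact ⟨hpS, by omega, hxu⟩
            · omega
            · exact ⟨hx, hxr, hxu⟩
          · intro x hx y hy hxy
            simp only [Finset.coe_filter, Set.mem_ofPred_eq, hτ'] at hx hy hxy
            split_ifs at hxy with h1 h2 h2
            · exact τinj hx.1 hy.1 (h1.trans h2.symm)
            · subst hxy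
              simp only [h2, if_false, if_true] at hy
              omega
            · subst hxy
              simp only [h1, if_false, if_true] at hx
              omega
            · exact hxy

theorem edf_dominates (S : Finset Packet) (hS : ∀ p ∈ S, p.r ≤ p.d ∧ 0 ≤ p.v)
    (σ : Packet → ℕ) (hinj : Set.InjOn σ ↑S)
    (hwin : ∀ p ∈ S, p.r ≤ σ p ∧ σ p ≤ p.d) :
    ∀ sched : ℕ → Option Packet, IsEDFSched S sched →
      -- EDF transmits every packet of S by its deadline
      (∀ p ∈ S, ∃ s : ℕ, s ≤ p.d ∧ sched s = some p) ∧
      -- at every time, EDF stores no more packets than σ does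
      (∀ t : ℕ,
        (S.filter fun p => p.r ≤ t ∧ ∃ s : ℕ, t ≤ s ∧ sched s = some p).card ≤
          (S.filter fun p => p.r ≤ t ∧ t ≤ σ p).card) ∧
      -- in particular, if σ witnesses B-feasibility, then so does EDF
      (∀ B : ℕ, 1 ≤ B → (∀ t : ℕ, (S.filter fun p => p.r ≤ t ∧ t ≤ σ p).card ≤ B) →
        ∀ t : ℕ,
          (S.filter fun p => p.r ≤ t ∧ ∃ s : ℕ, t ≤ s ∧ sched s = some p).card ≤ B) := by
  intro sched h
  obtain ⟨τ, -, τwin, τagree, τload⟩ :=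
    h.exists_agreeing_assignment hinj hwin (S.sup Packet.d + 1)
  have hlt : ∀ p ∈ S, p.d < S.sup Packet.d + 1 :=
    fun p hp => Nat.lt_succ_of_le (Finset.le_sup (f := Packet.d) hp)
  have hload : ∀ t : ℕ,
      (S.filter fun p => p.r ≤ t ∧ ∃ s : ℕ, t ≤ s ∧ sched s = some p).card ≤
        (S.filter fun p => p.r ≤ t ∧ t ≤ σ p).card := by
    intro t
    refine le_trans (Finset.card_le_card fun p => ?_) (τload t)
    simp only [Finset.mem_filter]
    rintro ⟨hp, hpr, s, hts, hs⟩
    have hsd : s ≤ p.d := ((h s).1 p hs).2.2.1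
    have hτs := (τagree p hp s (hsd.trans_lt (hlt p hp))).1 hs
    exact ⟨hp, hpr, hτs ▸ hts⟩
  refine ⟨fun p hp => ⟨τ p, (τwin p hp).2, ?_⟩, hload, fun B _ hB t => (hload t).trans (hB t)⟩
  exact (τagree p hp _ ((τwin p hp).2.trans_lt (hlt p hp))).2 rfl
end

section
/- For every integer B ≥ 2 and every real ε > 0, the set {p_1, p'_2, p'_3, …, p'_B, q_2, q_3, …, q_B} is a B-feasible subset of the instance I(B,ε) with total value (1+ε)B + (B−1): a witnessing schedule transmits p_1 at time 1, p'_i at time i for i = 2, …, B, and q_i at time B + i − 1 for i = 2, …, B, and at every time at most B of these packets are simultaneously stored. -/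
attribute [local instance] Classical.propDecidable

/-- The witnessing schedule: it transmits `p_1` at time 1, `p'_i` at time `i`
(`i = 2, …, B`), and `q_i` at time `B + i − 1` (`i = 2, …, B`). -/
noncomputable def witnessSched : Packet → ℕ := fun p => if p.v = 1 then p.d - 1 else p.d

theorem ppkt_one (ε : ℝ) : ppkt ε 1 = p'pkt ε 1 := rfl

theorem witnessSched_p'pkt {ε : ℝ} (hε : 0 < ε) (i : ℕ) : witnessSched (p'pkt ε i) = i := by
  simp [witnessSched, p'pkt, hε.ne']

theorem witnessSched_qpkt (B i : ℕ) : witnessSched (qpkt B i) = B + i - 1 := by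
  simp [witnessSched, qpkt]

theorem p'pkt_ne_qpkt {ε : ℝ} (hε : 0 < ε) (B i j : ℕ) : p'pkt ε i ≠ qpkt B j := fun h => by
  have hv : 1 + ε = 1 := congrArg Packet.v h
  linarith

theorem singleton_ppkt_union_image_p'pkt {B : ℕ} (hB : 1 ≤ B) (ε : ℝ) :
    {ppkt ε 1} ∪ (Finset.Icc 2 B).image (p'pkt ε) = (Finset.Icc 1 B).image (p'pkt ε) := by
  rw [ppkt_one, ← Finset.insert_eq, ← Finset.image_insert]
  congr 1
  ext i
  simp only [Finset.mem_insert, Finset.mem_Icc]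
  omega

theorem feasible_optimal_set (B : ℕ) (hB : 2 ≤ B) (ε : ℝ) (hε : 0 < ε) :
    let S : Finset Packet :=
      {ppkt ε 1} ∪ (Finset.Icc 2 B).image (p'pkt ε) ∪ (Finset.Icc 2 B).image (qpkt B)
    S ⊆ InstI B ε ∧
    -- the witnessing schedule sends p_1 at time 1, p'_i at time i, q_i at time B+i−1
    (witnessSched (ppkt ε 1) = 1) ∧
    (∀ i ∈ Finset.Icc 2 B, witnessSched (p'pkt ε i) = i) ∧
    (∀ i ∈ Finset.Icc 2 B, witnessSched (qpkt B i) = B + i - 1) ∧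
    -- it witnesses B-feasibility of S
    Set.InjOn witnessSched ↑S ∧
    (∀ p ∈ S, p.r ≤ witnessSched p ∧ witnessSched p ≤ p.d) ∧
    (∀ t : ℕ, (S.filter fun p => p.r ≤ t ∧ t ≤ witnessSched p).card ≤ B) ∧
    Feasible B S ∧
    -- and S has total value (1+ε)B + (B−1)
    totalValue S = (1 + ε) * B + ((B : ℝ) - 1) := by
  intro S
  have hS : S = (Finset.Icc 1 B).image (p'pkt ε) ∪ (Finset.Icc 2 B).image (qpkt B) :=
    congrArg (· ∪ _) (singleton_ppkt_union_image_p'pkt (by omega) ε)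
  have mem_S : ∀ p, p ∈ S ↔
      (∃ i, (1 ≤ i ∧ i ≤ B) ∧ p'pkt ε i = p) ∨ ∃ i, (2 ≤ i ∧ i ≤ B) ∧ qpkt B i = p := by
    intro p
    simp only [hS, Finset.mem_union, Finset.mem_image, Finset.mem_Icc]
  have hsub : S ⊆ InstI B ε := by
    intro p hp
    simp only [S, InstI, Finset.mem_union, Finset.mem_singleton, Finset.mem_image,
      Finset.mem_Icc] at hp ⊢
    rcases hp with (rfl | hp) | ⟨i, hi, rfl⟩
    · exact Or.inl (Or.inr ⟨1, by omega, rfl⟩)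
    · exact Or.inr hp
    · exact Or.inl (Or.inl ⟨i, by omega, rfl⟩)
  have hinj : Set.InjOn witnessSched ↑S := by
    intro p hp p₂ hp₂ h
    rw [Finset.mem_coe, mem_S] at hp hp₂
    rcases hp with ⟨i, hi, rfl⟩ | ⟨i, hi, rfl⟩ <;> rcases hp₂ with ⟨j, hj, rfl⟩ | ⟨j, hj, rfl⟩ <;>
      simp only [witnessSched_p'pkt hε, witnessSched_qpkt] at h
    · rw [h]
    · omega
    · omega
    · rw [show i = j by omega]
  have hwindow : ∀ p ∈ S, p.r ≤ witnessSched p ∧ witnessSched p ≤ p.d := by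
    intro p hp
    rw [mem_S] at hp
    rcases hp with ⟨i, hi, rfl⟩ | ⟨i, hi, rfl⟩
    · rw [witnessSched_p'pkt hε]
      exact ⟨le_rfl, le_rfl⟩
    · rw [witnessSched_qpkt]
      simp only [qpkt]
      omega
  have hbuffer : ∀ t : ℕ, (S.filter fun p => p.r ≤ t ∧ t ≤ witnessSched p).card ≤ B := by
    intro t
    have hstored : (S.filter fun p => p.r ≤ t ∧ t ≤ witnessSched p) ⊆
        insert (p'pkt ε t) ((Finset.Icc 2 B).image (qpkt B)) := by
      intro p hp
      rw [Finset.mem_filter, mem_S] at hp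
      obtain ⟨⟨i, hi, rfl⟩ | ⟨i, hi, rfl⟩, hr, ht⟩ := hp
      · rw [witnessSched_p'pkt hε] at ht
        rw [show i = t from le_antisymm hr ht]
        exact Finset.mem_insert_self _ _
      · exact Finset.mem_insert_of_mem
          (Finset.mem_image_of_mem _ (Finset.mem_Icc.mpr hi))
    calc _ ≤ _ := Finset.card_le_card hstored
      _ ≤ ((Finset.Icc 2 B).image (qpkt B)).card + 1 := Finset.card_insert_le _ _
      _ ≤ (Finset.Icc 2 B).card + 1 := Nat.add_le_add_right Finset.card_image_le 1
      _ = B := by rw [Nat.card_Icc]; omega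
  refine ⟨hsub, witnessSched_p'pkt hε 1, fun i _ => witnessSched_p'pkt hε i,
    fun i _ => witnessSched_qpkt B i, hinj, hwindow, hbuffer,
    ⟨witnessSched, hinj, hwindow, hbuffer⟩, ?_⟩
  have hdisj : Disjoint ((Finset.Icc 1 B).image (p'pkt ε)) ((Finset.Icc 2 B).image (qpkt B)) := by
    simp only [Finset.disjoint_left, Finset.mem_image]
    rintro _ ⟨i, _, rfl⟩ ⟨j, _, h⟩
    exact p'pkt_ne_qpkt hε B i j h.symm
  rw [totalValue, hS, Finset.sum_union hdisj,
    Finset.sum_image (p'pkt_injective ε).injOn, Finset.sum_image (qpkt_injective B).injOn]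
  simp only [p'pkt, qpkt, Finset.sum_const, Nat.card_Icc, nsmul_eq_mul]
  rw [show B + 1 - 1 = B by omega, show B + 1 - 2 = B - 1 by omega,
    Nat.cast_sub (by omega : 1 ≤ B)]
  push_cast
  ring
end

section
/- Let S be a finite set of packets and let B ∈ ℕ satisfy B ≥ 1 + max_{p ∈ S}(d_p − r_p) (the buffer size exceeds the slack time d_p − r_p of every packet). Then S is B-feasible if and only if there exists an injective function σ : S → ℕ with r_p ≤ σ(p) ≤ d_p for every p ∈ S; that is, the buffer-size constraint is vacuous and the bounded buffer model coincides with the bounded-delay model. -/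
attribute [local instance] Classical.propDecidable

theorem large_buffer_is_bounded_delay (S : Finset Packet)
    (hS : ∀ p ∈ S, p.r ≤ p.d ∧ 0 ≤ p.v) (B : ℕ)
    (hB : 1 + S.sup (fun p => p.d - p.r) ≤ B) :
    Feasible B S ↔
      ∃ σ : Packet → ℕ, Set.InjOn σ ↑S ∧ ∀ p ∈ S, p.r ≤ σ p ∧ σ p ≤ p.d := by
  refine ⟨fun ⟨σ, hinj, hσ, _⟩ => ⟨σ, hinj, hσ⟩, fun ⟨σ, hinj, hσ⟩ => ⟨σ, hinj, hσ, fun t => ?_⟩⟩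
  set m := S.sup (fun p => p.d - p.r)
  have hmaps : ∀ p ∈ S.filter (fun p => p.r ≤ t ∧ t ≤ σ p), σ p ∈ Finset.Icc t (t + m) := by
    intro p hp
    obtain ⟨hpS, hrt, htσ⟩ := Finset.mem_filter.1 hp
    have hslack : p.d - p.r ≤ m := Finset.le_sup (f := fun p : Packet => p.d - p.r) hpS
    have hσd := (hσ p hpS).2
    exact Finset.mem_Icc.2 ⟨htσ, by omega⟩
  have hcard := Finset.card_le_card_of_injOn σ hmaps
    (hinj.mono (Finset.coe_subset.2 (Finset.filter_subset _ S)))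
  rw [Nat.card_Icc] at hcard
  omega
end
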